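/- Let E be a finite-dimensional real inner product space, let m ≥ 2, let A_1,…,A_m be nonempty closed subsets of E with A_{m+1} := A_1, and let λ ∈ [0,1]. For j = 1,…,m let T_{j,j+1} be the set-valued relaxed Douglas–Rachford operator for the pair (A_j, A_{j+1}), and let Λ_j ⊆ U_j ⊆ E (with Λ_{m+1} := Λ_1, U_{m+1} := U_1). Assume for each j = 1,…,m: (a) T_{j,j+1} is pointwise almost firmly nonexpansive (constant 1/2) at every y ∈ Λ_{j+1} on U_{j+1} with violation ε_{j,j+1} ≥ 0, i.e., ‖x⁺ − y⁺‖² ≤ (1 + ε_{j,j+1})‖x − y‖² − ‖(x⁺ − x) − (y⁺ − y)‖² for all y ∈ Λ_{j+1}, x ∈ U_{j+1}, x⁺ ∈ T_{j,j+1}(x), y⁺ ∈ T_{j,j+1}(y); (b) T_{j,j+1}(Λ_{j+1}) ⊆ Λ_j and T_{j,j+1}(U_{j+1}) ⊆ U_j. Then the cyclic relaxed Douglas–Rachford mapping T := T_{1,2} ∘ T_{2,3} ∘ … ∘ T_{m,m+1} is pointwise almost α-firmly nonexpansive at every y ∈ Λ_1 on U_1 with constant α = m/(m+1) and violation ε :=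 Π_{j=1}^m (1 + ε_{j,j+1}) − 1; that is, for all y ∈ Λ_1, x ∈ U_1, x⁺ ∈ T(x), y⁺ ∈ T(y): ‖x⁺ − y⁺‖² ≤ (1 + ε)‖x − y‖² − (1/m)·‖(x⁺ − x) − (y⁺ − y)‖². -/

import Mathlib

noncomputable section

/-- The (possibly set-valued) metric projector onto `A`. -/
def projSet {E : Type*} [NormedAddCommGroup E] (A : Set E) (x : E) : Set E :=
  {a | a ∈ A ∧ ∀ b ∈ A, ‖x - a‖ ≤ ‖x - b‖}

/-- The set-valued relaxed Douglas–Rachford operator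
`T_{A,B} = (λ/2)(R_A R_B + Id) + (1 − λ)P_B`. -/
def Tdr {E : Type*} [NormedAddCommGroup E] [InnerProductSpace ℝ E]
    (A B : Set E) (lam : ℝ) (x : E) : Set E :=
  {z | ∃ p ∈ projSet B x, ∃ q ∈ projSet A ((2:ℝ) • p - x),
    z = (lam / 2) • (((2:ℝ) • q - ((2:ℝ) • p - x)) + x) + (1 - lam) • p}

/-- Composition of set-valued mappings: `(S ∘ Q)(x) = ⋃_{y ∈ Q x} S y`. -/
def svComp {E : Type*} (S Q : E → Set E) : E → Set E := fun x => ⋃ y ∈ Q x, S y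

/-- Composition of a list of set-valued mappings (head applied last). -/
def svCompList {E : Type*} (l : List (E → Set E)) : E → Set E :=
  l.foldr svComp (fun x => {x})

theorem mem_svCompList_append_singleton {E : Type*} (l : List (E → Set E)) (S : E → Set E)
    (x z : E) : z ∈ svCompList (l ++ [S]) x ↔ ∃ w ∈ S x, z ∈ svCompList l w := by
  induction l generalizing z with
  | nil => simp [svCompList, svComp]
  | cons Q l ih =>
    have hcons : ∀ (l' : List (E → Set E)) (u : E),
        z ∈ svCompList (Q :: l') u ↔ ∃ v ∈ svCompList l' u, z ∈ Q v := by
      intro l' u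
      simp [svCompList, svComp]
    rw [List.cons_append, hcons]
    simp only [hcons, ih]
    constructor
    · rintro ⟨v, ⟨w, hw, hv⟩, hz⟩
      exact ⟨w, hw, v, hv, hz⟩
    · rintro ⟨w, hw, v, hv, hz⟩
      exact ⟨v, ⟨w, hw, hv⟩, hz⟩

theorem add_sq_le_succ_mul_add {n a b g h : ℝ} (hn : 0 ≤ n) (hg : 0 ≤ g)
    (ha : a ^ 2 ≤ n * g) (hb : b ^ 2 ≤ h) : (a + b) ^ 2 ≤ (n + 1) * (g + h) := by
  have hh : 0 ≤ h := (sq_nonneg b).trans hb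
  have hsq : (2 * a * b) ^ 2 ≤ (g + n * h) ^ 2 := by
    have := mul_le_mul ha hb (sq_nonneg b) (mul_nonneg hn hg)
    nlinarith [sq_nonneg (g - n * h)]
  have := abs_le_of_sq_le_sq' hsq (by positivity)
  linarith [this.2]

/-- A composition of `n` pointwise almost firmly nonexpansive maps is pointwise almost
`n/(n+1)`-firmly nonexpansive; the inequality is multiplied by `n` so that `n = 0` is allowed. -/
theorem svCompList_almost_averaged {E : Type*} [NormedAddCommGroup E]
    (F : ℕ → E → Set E) (Lam U : ℕ → Set E) (eps : ℕ → ℝ) (n : ℕ)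
    (heps : ∀ k < n, 0 ≤ eps k)
    (hF : ∀ k < n, ∀ y ∈ Lam (k + 1), ∀ x ∈ U (k + 1), ∀ xp ∈ F k x, ∀ yp ∈ F k y,
      ‖xp - yp‖ ^ 2 ≤ (1 + eps k) * ‖x - y‖ ^ 2 - ‖(xp - x) - (yp - y)‖ ^ 2)
    (hLam : ∀ k < n, ∀ z ∈ Lam (k + 1), F k z ⊆ Lam k)
    (hU : ∀ k < n, ∀ z ∈ U (k + 1), F k z ⊆ U k) :
    ∀ y ∈ Lam n, ∀ x ∈ U n, ∀ xp ∈ svCompList ((List.range n).map F) x,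
      ∀ yp ∈ svCompList ((List.range n).map F) y,
        ‖xp - yp‖ ^ 2 ≤ (∏ k ∈ Finset.range n, (1 + eps k)) * ‖x - y‖ ^ 2 ∧
        ‖(xp - x) - (yp - y)‖ ^ 2 ≤
          n * ((∏ k ∈ Finset.range n, (1 + eps k)) * ‖x - y‖ ^ 2 - ‖xp - yp‖ ^ 2) := by
  induction n with
  | zero =>
    intro y _ x _ xp hxp yp hyp
    simp only [svCompList, List.range_zero, List.map_nil, List.foldr_nil,
      Set.mem_singleton_iff] at hxp hyp
    simp [hxp, hyp]
  | succ n ih =>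
    intro y hy x hx xp hxp yp hyp
    simp only [List.range_succ, List.map_append, List.map_cons, List.map_nil,
      mem_svCompList_append_singleton] at hxp hyp
    obtain ⟨u, hu, hxp⟩ := hxp
    obtain ⟨v, hv, hyp⟩ := hyp
    have hn := n.lt_succ_self
    obtain ⟨h₁, h₂⟩ := ih (fun k hk => heps k (hk.trans hn)) (fun k hk => hF k (hk.trans hn))
      (fun k hk => hLam k (hk.trans hn)) (fun k hk => hU k (hk.trans hn))
      v (hLam n hn y hy hv) u (hU n hn x hx hu) xp hxp yp hyp
    have h₃ := hF n hn y hy x hx u hu v hv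
    have hP : 1 ≤ ∏ k ∈ Finset.range n, (1 + eps k) := by
      refine Finset.one_le_prod fun k hk => ?_
      linarith [heps k ((Finset.mem_range.1 hk).trans hn)]
    rw [Finset.prod_range_succ]
    set P := ∏ k ∈ Finset.range n, (1 + eps k)
    have h₄ : ‖(u - x) - (v - y)‖ ^ 2 ≤ P * ((1 + eps n) * ‖x - y‖ ^ 2 - ‖u - v‖ ^ 2) := by
      have h : ‖(u - x) - (v - y)‖ ^ 2 ≤ (1 + eps n) * ‖x - y‖ ^ 2 - ‖u - v‖ ^ 2 := by linarith
      exact h.trans (le_mul_of_one_le_left ((sq_nonneg _).trans h) hP)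
    refine ⟨by nlinarith [sq_nonneg ‖(u - x) - (v - y)‖], ?_⟩
    have htri : ‖(xp - x) - (yp - y)‖ ≤ ‖(xp - u) - (yp - v)‖ + ‖(u - x) - (v - y)‖ := by
      refine le_of_eq_of_le ?_ (norm_add_le _ _)
      congr 1
      abel
    have h₅ := add_sq_le_succ_mul_add n.cast_nonneg (sub_nonneg.2 h₁) h₂ h₄
    calc ‖(xp - x) - (yp - y)‖ ^ 2
        ≤ (‖(xp - u) - (yp - v)‖ + ‖(u - x) - (v - y)‖) ^ 2 := by gcongr
      _ ≤ _ := h₅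
      _ = _ := by push_cast; ring

/-- the cyclic relaxed Douglas–Rachford mapping built from pointwise almost
firmly nonexpansive factors is pointwise almost α-firmly nonexpansive with constant
`α = m/(m+1)` and violation `ε = Π(1 + ε_{j,j+1}) − 1`. -/
theorem stmt17
    {E : Type*} [NormedAddCommGroup E] [InnerProductSpace ℝ E] [FiniteDimensional ℝ E]
    (m : ℕ) (hm : 2 ≤ m)
    (A : ℕ → Set E)
    (hA : ∀ j ∈ Finset.Icc 1 (m+1), (A j).Nonempty ∧ IsClosed (A j))
    (hAper : A (m+1) = A 1)
    (lam : ℝ) (hlam : lam ∈ Set.Icc (0:ℝ) 1)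
    (Lam U : ℕ → Set E)
    (hLamper : Lam (m+1) = Lam 1) (hUper : U (m+1) = U 1)
    (hLU : ∀ j ∈ Finset.Icc 1 (m+1), Lam j ⊆ U j)
    (eps : ℕ → ℝ) (heps : ∀ j ∈ Finset.Icc 1 m, 0 ≤ eps j)
    (ha : ∀ j ∈ Finset.Icc 1 m, ∀ y ∈ Lam (j+1), ∀ x ∈ U (j+1),
      ∀ xp ∈ Tdr (A j) (A (j+1)) lam x, ∀ yp ∈ Tdr (A j) (A (j+1)) lam y,
        ‖xp - yp‖^2 ≤ (1 + eps j) * ‖x - y‖^2 - ‖(xp - x) - (yp - y)‖^2)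
    (hb : ∀ j ∈ Finset.Icc 1 m,
      (∀ z ∈ Lam (j+1), Tdr (A j) (A (j+1)) lam z ⊆ Lam j) ∧
      (∀ z ∈ U (j+1), Tdr (A j) (A (j+1)) lam z ⊆ U j)) :
    ∀ y ∈ Lam 1, ∀ x ∈ U 1,
      ∀ xp ∈ svCompList ((List.range m).map (fun k => Tdr (A (k+1)) (A (k+2)) lam)) x,
      ∀ yp ∈ svCompList ((List.range m).map (fun k => Tdr (A (k+1)) (A (k+2)) lam)) y,
        ‖xp - yp‖^2 ≤ (1 + ((∏ j ∈ Finset.Icc 1 m, (1 + eps j)) - 1)) * ‖x - y‖^2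
          - (1 / (m : ℝ)) * ‖(xp - x) - (yp - y)‖^2 := by
  have hmem : ∀ k < m, k + 1 ∈ Finset.Icc 1 m := fun k hk => Finset.mem_Icc.2 ⟨by omega, hk⟩
  intro y hy x hx xp hxp yp hyp
  obtain ⟨-, h⟩ := svCompList_almost_averaged (fun k => Tdr (A (k + 1)) (A (k + 2)) lam)
    (fun k => Lam (k + 1)) (fun k => U (k + 1)) (fun k => eps (k + 1)) m
    (fun k hk => heps _ (hmem k hk)) (fun k hk => ha _ (hmem k hk))
    (fun k hk => (hb _ (hmem k hk)).1) (fun k hk => (hb _ (hmem k hk)).2)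
    y (hLamper ▸ hy) x (hUper ▸ hx) xp hxp yp hyp
  have hprod : ∏ k ∈ Finset.range m, (1 + eps (k + 1)) = ∏ j ∈ Finset.Icc 1 m, (1 + eps j) := by
    rw [Finset.range_eq_Ico, Finset.prod_Ico_add' (fun j => 1 + eps j) 0 m 1]
    rfl
  rw [hprod] at h
  have hm0 : (0 : ℝ) < m := by exact_mod_cast (by omega : 0 < m)
  have := (div_le_iff₀' hm0).2 h
  rw [one_div_mul_eq_div]
  linarith
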